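/- arXiv:1405.7817 — 2 statements merged into one kernel-verified Lean document; each statement's English description precedes it below -/
import Mathlib

section
/- In the general spectral-gap setting, let h ∈ H and let N : H → H be bounded, demicontinuous with N(0) = 0, and assume: (i) there exists α > γ/δ² such that Re⟨N(u) − N(u'), u − u'⟩ ≥ α‖N(u) − N(u')‖² for all u, u' ∈ H; (ii) limsup_{k→∞} Re⟨N(u_k), u_k⟩/‖u_k‖ > γ‖h‖/(δ²α − γ) for every sequence {u_k} ⊂ H with ‖u_k‖ → +∞; (iii) J_N(u) > γ‖h‖/(δ²α − γ) + Re⟨h, u⟩ for every u ∈ ker L with ‖u‖ = 1. Then the equation Lu + N(u) = h has a solution u ∈ dom L. -/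
open Filter Topology

/-- The recession functional `J_N` of an operator `N` on a complex Hilbert space:
`J_N(u) = inf { liminf_k Re⟪N(t_k v_k), v_k⟫ : t_k → +∞, t_k > 0, v_k ⇀ u weakly }`,
with values in the extended reals. -/
noncomputable def recessionFunctional {H : Type*} [NormedAddCommGroup H]
    [InnerProductSpace ℂ H] (N : H → H) (u : H) : EReal :=
  sInf { J : EReal | ∃ (t : ℕ → ℝ) (v : ℕ → H),
    (∀ k, 0 < t k) ∧ Tendsto t atTop atTop ∧
    (∀ w : H, Tendsto (fun k => (inner ℂ w (v k) : ℂ)) atTop (𝓝 (inner ℂ w u))) ∧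
    J = Filter.liminf
      (fun k => (((inner ℂ (N ((t k : ℂ) • v k)) (v k) : ℂ).re : ℝ) : EReal)) atTop }

/-- Bounded sequences in a separable Hilbert space have weakly convergent subsequences. -/
theorem exists_subseq_weakly_tendsto {H : Type*} [NormedAddCommGroup H] [InnerProductSpace ℂ H]
    [CompleteSpace H] [TopologicalSpace.SeparableSpace H] (v : ℕ → H) (C : ℝ)
    (hv : ∀ k, ‖v k‖ ≤ C) :
    ∃ (u : H) (φ : ℕ → ℕ), StrictMono φ ∧
      ∀ w : H, Tendsto (fun k => (inner ℂ w (v (φ k)) : ℂ)) atTop (𝓝 (inner ℂ w u)) := by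
  obtain ⟨a, -, φ, hφ, ha⟩ := WeakDual.isSeqCompact_closedBall ℂ H 0 C
    (x := fun k => StrongDual.toWeakDual (InnerProductSpace.toDual ℂ H (v k)))
    (fun k => by simpa using hv k)
  refine ⟨(InnerProductSpace.toDual ℂ H).symm (WeakDual.toStrongDual a), φ, hφ, fun w => ?_⟩
  have h1 := ((WeakDual.eval_continuous w).tendsto a).comp ha
  have h2 := (Complex.continuous_conj.tendsto _).comp h1
  rw [← inner_conj_symm, InnerProductSpace.toDual_symm_apply]
  refine h2.congr fun k => ?_
  simp [InnerProductSpace.toDual_apply_apply]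

/-- A self-adjoint operator shifted by a real number is onto as soon as it is bounded below. -/
theorem exists_add_smul_eq_of_bounded_below {H : Type*} [NormedAddCommGroup H]
    [InnerProductSpace ℂ H] [CompleteSpace H] (dom : Submodule ℂ H) (L : H → H)
    (hlin : ∀ u ∈ dom, ∀ v ∈ dom, ∀ a b : ℂ, L (a • u + b • v) = a • L u + b • L v)
    (hsymm : ∀ u ∈ dom, ∀ v ∈ dom, (inner ℂ (L u) v : ℂ) = inner ℂ u (L v))
    (hselfadj : ∀ v w : H, (∀ u ∈ dom, (inner ℂ v (L u) : ℂ) = inner ℂ w u) → v ∈ dom ∧ L v = w)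
    (c m : ℝ) (hm : 0 < m) (hbelow : ∀ u ∈ dom, m * ‖u‖ ≤ ‖L u + (c : ℂ) • u‖) (w : H) :
    ∃ u ∈ dom, L u + (c : ℂ) • u = w := by
  let M : dom →ₗ[ℂ] H :=
    { toFun := fun u => L u + (c : ℂ) • (u : H)
      map_add' := fun u v => by
        have := hlin u u.2 v v.2 1 1
        simp only [one_smul] at this
        simp only [Submodule.coe_add, this, smul_add]
        abel
      map_smul' := fun a u => by
        have := hlin u u.2 0 dom.zero_mem a 0
        simp only [smul_zero, add_zero, zero_smul] at this
        simp only [Submodule.coe_smul, this, smul_add, RingHom.id_apply, smul_comm a] }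
  have hM : ∀ u : dom, M u = L u + (c : ℂ) • (u : H) := fun u => rfl
  have hMb : ∀ u : dom, m * ‖u‖ ≤ ‖M u‖ := fun u => hbelow u u.2
  have hclosed : IsClosed (M.range : Set H) := by
    refine IsSeqClosed.isClosed fun x y hx hxy => ?_
    choose u hu using hx
    have hcau : CauchySeq (fun k => (u k : H)) := by
      have hx' := hxy.cauchySeq
      rw [Metric.cauchySeq_iff'] at hx' ⊢
      intro ε hε
      obtain ⟨K, hK⟩ := hx' (m * ε) (by positivity)
      refine ⟨K, fun n hn => ?_⟩
      have h1 := hK n hn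
      have h2 := hMb (u n - u K)
      rw [map_sub, hu, hu, ← dist_eq_norm (x n)] at h2
      have h3 : dist (u n : H) (u K : H) = ‖u n - u K‖ := by
        rw [dist_eq_norm]; rfl
      rw [h3]
      exact lt_of_mul_lt_mul_left (h2.trans_lt h1) hm.le
    obtain ⟨v, hv⟩ := cauchySeq_tendsto_of_complete hcau
    have hLv : v ∈ dom ∧ L v = y - (c : ℂ) • v := by
      refine hselfadj v _ fun z hz => ?_
      have h1 : Tendsto (fun k => (inner ℂ (u k : H) (L z) : ℂ)) atTop (𝓝 (inner ℂ v (L z))) :=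
        hv.inner tendsto_const_nhds
      have h2 : Tendsto (fun k => (inner ℂ (x k - (c : ℂ) • (u k : H)) z : ℂ)) atTop
          (𝓝 (inner ℂ (y - (c : ℂ) • v) z)) :=
        (hxy.sub (hv.const_smul _)).inner tendsto_const_nhds
      refine tendsto_nhds_unique h1 (h2.congr fun k => ?_)
      rw [← hsymm _ (u k).2 _ hz, ← hu, hM]
      simp
    exact ⟨⟨v, hLv.1⟩, by rw [hM]; simp [hLv.2]⟩
  have hbot : (M.range)ᗮ = ⊥ := by
    rw [Submodule.eq_bot_iff]
    intro v hv
    have h0 : v ∈ dom ∧ L v = -((c : ℂ) • v) := by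
      refine hselfadj v _ fun u hu => ?_
      have := Submodule.inner_left_of_mem_orthogonal (LinearMap.mem_range_self M ⟨u, hu⟩) hv
      rw [hM] at this
      simp only [inner_add_right, inner_smul_right] at this
      simp only [inner_neg_left, inner_smul_left, Complex.conj_ofReal]
      linear_combination this
    have h1 := hbelow v h0.1
    rw [h0.2, neg_add_cancel, norm_zero] at h1
    exact norm_le_zero_iff.1 (by nlinarith [norm_nonneg v])
  have : CompleteSpace M.range := hclosed.completeSpace_coe
  have htop := (Submodule.orthogonal_eq_bot_iff (K := M.range)).1 hbot
  obtain ⟨u, hu⟩ : w ∈ M.range := htop ▸ Submodule.mem_top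
  exact ⟨u, u.2, hu⟩

/-- If `a` and `A` satisfy `Re⟪A, a⟫ ≤ -δ‖a‖²`, then `‖A‖` controls `a` and `Re⟪A, a⟫`. -/
theorem bounds_of_re_inner_le {H : Type*} [NormedAddCommGroup H] [InnerProductSpace ℂ H]
    {a A : H} {δ : ℝ} (hδ : 0 < δ) (h : (inner ℂ A a : ℂ).re ≤ -δ * ‖a‖ ^ 2) :
    δ * ‖a‖ ≤ ‖A‖ ∧ -(1 / δ) * ‖A‖ ^ 2 ≤ (inner ℂ A a : ℂ).re := by
  have h1 : -(‖A‖ * ‖a‖) ≤ (inner ℂ A a : ℂ).re := by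
    have := (Complex.abs_re_le_norm _).trans (norm_inner_le_norm (𝕜 := ℂ) A a)
    exact (abs_le.1 this).1
  have h2 : δ * ‖a‖ ≤ ‖A‖ := by
    rcases (norm_nonneg a).eq_or_lt with h0 | h0
    · rw [← h0]; simp
    · nlinarith
  refine ⟨h2, ?_⟩
  have h3 : ‖a‖ ≤ 1 / δ * ‖A‖ := by
    rw [div_mul_eq_mul_div, one_mul, le_div_iff₀ hδ]; linarith
  nlinarith [mul_le_mul_of_nonneg_left h3 (norm_nonneg A)]

theorem norm_sq_add_of_inner_eq_zero {H : Type*} [NormedAddCommGroup H] [InnerProductSpace ℂ H]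
    {a b : H} (h : (inner ℂ a b : ℂ) = 0) : ‖a + b‖ ^ 2 = ‖a‖ ^ 2 + ‖b‖ ^ 2 := by
  have := norm_add_sq (𝕜 := ℂ) a b
  rw [h] at this
  simpa using this

/-- For an operator with a spectral gap `(-δ, 0)`, the shifted operator `r L + c` with
`c ≤ (r - q) δ` satisfies a lower norm bound and a lower bound on its quadratic form. -/
theorem spectral_gap_bounds {H : Type*} [NormedAddCommGroup H] [InnerProductSpace ℂ H]
    (H₁ dom : Submodule ℂ H) (hH₁dom : H₁ ≤ dom)
    (P₁ : H → H) (hP₁mem : ∀ u : H, P₁ u ∈ H₁) (hP₁orth : ∀ u : H, u - P₁ u ∈ H₁ᗮ)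
    (L : H → H)
    (hlin : ∀ u ∈ dom, ∀ v ∈ dom, ∀ a b : ℂ, L (a • u + b • v) = a • L u + b • L v)
    (hinv₁ : ∀ u ∈ H₁, L u ∈ H₁)
    (hinv₂ : ∀ u ∈ dom, u ∈ H₁ᗮ → L u ∈ H₁ᗮ)
    (δ : ℝ) (hcoer₁ : ∀ u ∈ H₁, (inner ℂ (L u) u : ℂ).re ≤ -δ * ‖u‖ ^ 2)
    (hnn₂ : ∀ u ∈ dom, u ∈ H₁ᗮ → 0 ≤ (inner ℂ (L u) u : ℂ).re)
    (r c q : ℝ) (hr : 0 < r) (hc : 0 ≤ c) (hq : 0 < q) (hqr : q + c ≤ r * δ) :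
    ∀ u ∈ dom, min q c * ‖u‖ ≤ ‖(r : ℂ) • L u + (c : ℂ) • u‖ ∧
      -(1 / q) * ‖(r : ℂ) • L u + (c : ℂ) • u‖ ^ 2 ≤
        (inner ℂ ((r : ℂ) • L u + (c : ℂ) • u) u : ℂ).re := by
  intro u hu
  obtain ⟨a, b, ha, hb, hbd, rfl⟩ : ∃ a b : H, a ∈ H₁ ∧ b ∈ H₁ᗮ ∧ b ∈ dom ∧ u = a + b :=
    ⟨P₁ u, u - P₁ u, hP₁mem u, hP₁orth u, dom.sub_mem hu (hH₁dom (hP₁mem u)), by abel⟩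
  have hL : L (a + b) = L a + L b := by
    simpa using hlin a (hH₁dom ha) b hbd 1 1
  set A : H := (r : ℂ) • L a + (c : ℂ) • a with hA
  set B : H := (r : ℂ) • L b + (c : ℂ) • b with hB
  have hAm : A ∈ H₁ := H₁.add_mem (H₁.smul_mem _ (hinv₁ a ha)) (H₁.smul_mem _ ha)
  have hBm : B ∈ H₁ᗮ :=
    (H₁ᗮ).add_mem ((H₁ᗮ).smul_mem _ (hinv₂ b hbd hb)) ((H₁ᗮ).smul_mem _ hb)
  have hsum : (r : ℂ) • L (a + b) + (c : ℂ) • (a + b) = A + B := by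
    rw [hL, hA, hB, smul_add, smul_add]; abel
  have re_form : ∀ x : H, (inner ℂ ((r : ℂ) • L x + (c : ℂ) • x) x : ℂ).re
      = r * (inner ℂ (L x) x : ℂ).re + c * ‖x‖ ^ 2 := by
    intro x
    have h1 : (inner ℂ x x : ℂ).re = ‖x‖ ^ 2 := inner_self_eq_norm_sq (𝕜 := ℂ) x
    rw [inner_add_left, inner_smul_left, inner_smul_left, Complex.conj_ofReal,
      Complex.conj_ofReal, Complex.add_re, Complex.re_ofReal_mul, Complex.re_ofReal_mul, h1]
  have hAa : (inner ℂ A a : ℂ).re ≤ -q * ‖a‖ ^ 2 := by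
    rw [hA, re_form]
    nlinarith [mul_le_mul_of_nonneg_left (hcoer₁ a ha) hr.le,
      mul_le_mul_of_nonneg_right hqr (sq_nonneg ‖a‖)]
  have hBb : c * ‖b‖ ^ 2 ≤ (inner ℂ B b : ℂ).re := by
    rw [hB, re_form]
    nlinarith [mul_nonneg hr.le (hnn₂ b hbd hb)]
  have hcB : c * ‖b‖ ≤ ‖B‖ := by
    have h1 := (Complex.re_le_norm _).trans (norm_inner_le_norm (𝕜 := ℂ) B b)
    rcases (norm_nonneg b).eq_or_lt with h0 | h0
    · rw [← h0]; simp
    · nlinarith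
  obtain ⟨hqA, hform⟩ := bounds_of_re_inner_le hq hAa
  have hAB := norm_sq_add_of_inner_eq_zero (Submodule.inner_right_of_mem_orthogonal hAm hBm)
  have hab := norm_sq_add_of_inner_eq_zero (Submodule.inner_right_of_mem_orthogonal ha hb)
  have hAb : (inner ℂ A b : ℂ) = 0 := Submodule.inner_right_of_mem_orthogonal hAm hb
  have hBa : (inner ℂ B a : ℂ) = 0 := Submodule.inner_left_of_mem_orthogonal ha hBm
  rw [hsum]
  have hmin : 0 ≤ min q c := le_min hq.le hc
  constructor
  · refine le_of_sq_le_sq ?_ (norm_nonneg _)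
    rw [mul_pow, hab, hAB, mul_add, ← mul_pow, ← mul_pow]
    have h1 : min q c * ‖a‖ ≤ ‖A‖ :=
      (mul_le_mul_of_nonneg_right (min_le_left _ _) (norm_nonneg _)).trans hqA
    have h2 : min q c * ‖b‖ ≤ ‖B‖ :=
      (mul_le_mul_of_nonneg_right (min_le_right _ _) (norm_nonneg _)).trans hcB
    gcongr
  · rw [inner_add_left, inner_add_right, inner_add_right, hAb, hBa, add_zero, zero_add,
      Complex.add_re, hAB]
    have h1 : 0 ≤ 1 / q * ‖B‖ ^ 2 := by positivity
    have h2 : 0 ≤ c * ‖b‖ ^ 2 := by positivity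
    linarith

/-- A nonexpansive map has fixed points of its contractive scalings. -/
theorem exists_scaled_fixedPoint {H : Type*} [NormedAddCommGroup H] [InnerProductSpace ℂ H]
    [CompleteSpace H] (T : H → H) (hT : LipschitzWith 1 T) (ε : ℝ) (hε : 0 < ε) :
    ∃ z, T z = ((1 + ε : ℝ) : ℂ) • z := by
  have hn : ‖(((1 + ε : ℝ) : ℂ))⁻¹‖ < 1 := by
    rw [norm_inv, Complex.norm_real, Real.norm_of_nonneg (by positivity)]
    exact inv_lt_one_of_one_lt₀ (by linarith)
  have hcon : ContractingWith ‖(((1 + ε : ℝ) : ℂ))⁻¹‖₊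
      (fun z => (((1 + ε : ℝ) : ℂ))⁻¹ • T z) := by
    refine ⟨hn, LipschitzWith.of_dist_le_mul fun x y => ?_⟩
    rw [dist_smul₀, coe_nnnorm]
    gcongr
    simpa using hT.dist_le_mul x y
  refine ⟨hcon.fixedPoint, ?_⟩
  have hne : ((1 + ε : ℝ) : ℂ) ≠ 0 := by
    exact_mod_cast (by positivity : (1 + ε : ℝ) ≠ 0)
  have h1 := hcon.fixedPoint_isFixedPt
  have h2 : (((1 + ε : ℝ) : ℂ))⁻¹ • T hcon.fixedPoint = hcon.fixedPoint := h1
  rw [inv_smul_eq_iff₀ hne] at h2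
  exact h2

/-- Comparison of two scaled fixed points of a nonexpansive map. -/
theorem norm_sub_sq_le_of_scaled_fixedPoints {H : Type*} [NormedAddCommGroup H]
    [InnerProductSpace ℂ H] (T : H → H) (hT : LipschitzWith 1 T) {ε ε' : ℝ} (hε' : 0 < ε')
    (hε : ε' < ε) {z z' : H} (hz : T z = ((1 + ε : ℝ) : ℂ) • z)
    (hz' : T z' = ((1 + ε' : ℝ) : ℂ) • z') :
    ‖z - z'‖ ^ 2 ≤ ‖z'‖ ^ 2 - ‖z‖ ^ 2 := by
  have h1 : (inner ℂ (T z - T z') (z - z') : ℂ).re ≤ ‖z - z'‖ ^ 2 := by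
    have h2 := (Complex.re_le_norm _).trans (norm_inner_le_norm (𝕜 := ℂ) (T z - T z') (z - z'))
    have h3 : ‖T z - T z'‖ ≤ ‖z - z'‖ := by
      simpa [dist_eq_norm] using hT.dist_le_mul z z'
    nlinarith [norm_nonneg (z - z')]
  have hzz : (inner ℂ z z : ℂ).re = ‖z‖ ^ 2 := inner_self_eq_norm_sq (𝕜 := ℂ) z
  have hzz' : (inner ℂ z' z' : ℂ).re = ‖z'‖ ^ 2 := inner_self_eq_norm_sq (𝕜 := ℂ) z'
  have hsy : (inner ℂ z' z : ℂ).re = (inner ℂ z z' : ℂ).re := inner_re_symm (𝕜 := ℂ) z' z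
  have hd : ‖z - z'‖ ^ 2 = ‖z‖ ^ 2 - 2 * (inner ℂ z z' : ℂ).re + ‖z'‖ ^ 2 :=
    norm_sub_sq (𝕜 := ℂ) z z'
  rw [hz, hz'] at h1
  simp only [inner_sub_left, inner_sub_right, inner_smul_left, Complex.conj_ofReal,
    Complex.sub_re, Complex.re_ofReal_mul, hzz, hzz', hsy] at h1
  rw [hd] at h1 ⊢
  set x := ‖z‖ ^ 2
  set y := ‖z'‖ ^ 2
  set p := (inner ℂ z z' : ℂ).re
  have hd0 : 0 ≤ x - 2 * p + y := hd ▸ sq_nonneg _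
  have hkey : (ε + ε') * (x - 2 * p + y) ≤ (ε - ε') * (y - x) := by linarith
  have hyx : 0 ≤ y - x := by
    by_contra hcon
    push Not at hcon
    nlinarith [mul_nonneg (by linarith : 0 ≤ ε + ε') hd0]
  nlinarith

/-- If the scaled fixed points of a nonexpansive map stay bounded along `1 / (k + 1)`,
then the map has a fixed point. -/
theorem exists_fixedPoint_of_bounded {H : Type*} [NormedAddCommGroup H]
    [InnerProductSpace ℂ H] [CompleteSpace H] (T : H → H) (hT : LipschitzWith 1 T)
    (ε₀ B : ℝ) (hε₀ : 0 < ε₀)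
    (hB : ∀ ε : ℝ, 0 < ε → ε < ε₀ → ∀ z, T z = ((1 + ε : ℝ) : ℂ) • z → ‖z‖ ≤ B) :
    ∃ z, T z = z := by
  set ε : ℕ → ℝ := fun k => ε₀ / (k + 2) with hεdef
  have hεpos : ∀ k, 0 < ε k := fun k => by positivity
  have hεlt : ∀ k, ε k < ε₀ := fun k => by
    rw [hεdef]
    have : (0 : ℝ) ≤ k := k.cast_nonneg
    exact div_lt_self hε₀ (by linarith)
  have hεanti : ∀ m n : ℕ, m < n → ε n < ε m := fun m n hmn => by
    have : (m : ℝ) < n := by exact_mod_cast hmn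
    exact div_lt_div_of_pos_left hε₀ (by positivity) (by linarith)
  have hεlim : Tendsto ε atTop (𝓝 0) :=
    Tendsto.const_div_atTop
      (tendsto_atTop_add_const_right _ _ tendsto_natCast_atTop_atTop) ε₀
  choose z hz using fun k => exists_scaled_fixedPoint T hT (ε k) (hεpos k)
  have hcomp : ∀ m n : ℕ, m ≤ n → ‖z m - z n‖ ^ 2 ≤ ‖z n‖ ^ 2 - ‖z m‖ ^ 2 := by
    intro m n hmn
    rcases hmn.eq_or_lt with rfl | hlt
    · simp
    · exact norm_sub_sq_le_of_scaled_fixedPoints T hT (hεpos n) (hεanti m n hlt) (hz m) (hz n)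
  have hmono : Monotone (fun k => ‖z k‖ ^ 2) := fun m n hmn => by
    have := hcomp m n hmn
    have h2 := sq_nonneg ‖z m - z n‖
    show ‖z m‖ ^ 2 ≤ ‖z n‖ ^ 2
    linarith
  have hbdd : BddAbove (Set.range fun k => ‖z k‖ ^ 2) := by
    refine ⟨B ^ 2, ?_⟩
    rintro _ ⟨k, rfl⟩
    have := hB (ε k) (hεpos k) (hεlt k) (z k) (hz k)
    show ‖z k‖ ^ 2 ≤ B ^ 2
    gcongr
  have hconv := (tendsto_atTop_ciSup hmono hbdd).cauchySeq
  have hcau : CauchySeq z := by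
    rw [Metric.cauchySeq_iff'] at hconv ⊢
    intro η hη
    obtain ⟨K, hK⟩ := hconv (η ^ 2) (by positivity)
    refine ⟨K, fun n hn => ?_⟩
    have h1 := hK n hn
    rw [Real.dist_eq] at h1
    have h2 := hcomp K n hn
    rw [dist_comm, dist_eq_norm]
    exact lt_of_pow_lt_pow_left₀ 2 hη.le (h2.trans_lt ((le_abs_self _).trans_lt h1))
  obtain ⟨x, hx⟩ := cauchySeq_tendsto_of_complete hcau
  refine ⟨x, ?_⟩
  have h1 : Tendsto (fun k => T (z k)) atTop (𝓝 (T x)) := (hT.continuous.tendsto x).comp hx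
  have h2 : Tendsto (fun k => ((1 + ε k : ℝ) : ℂ) • z k) atTop (𝓝 (((1 + 0 : ℝ) : ℂ) • x)) :=
    ((Complex.continuous_ofReal.tendsto _).comp (hεlim.const_add 1)).smul hx
  have h3 := tendsto_nhds_unique h1 (h2.congr fun k => (hz k).symm)
  simpa using h3

/-- A priori bound: solutions of the regularized equations cannot escape to infinity. -/
theorem not_tendsto_norm_atTop_of_regularized {H : Type*} [NormedAddCommGroup H]
    [InnerProductSpace ℂ H] [CompleteSpace H] [TopologicalSpace.SeparableSpace H]
    (dom : Submodule ℂ H) (L : H → H)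
    (hsymm : ∀ u ∈ dom, ∀ v ∈ dom, (inner ℂ (L u) v : ℂ) = inner ℂ u (L v))
    (hselfadj : ∀ v w : H, (∀ u ∈ dom, (inner ℂ v (L u) : ℂ) = inner ℂ w u) → v ∈ dom ∧ L v = w)
    (h : H) (N : H → H) (α κ s : ℝ) (hκ : 0 ≤ κ) (hκα : κ < α) (hs : 0 < s)
    (hN : ∀ u : H, α * ‖N u‖ ^ 2 ≤ (inner ℂ (N u) u : ℂ).re)
    (hii : ∀ u : ℕ → H, Tendsto (fun k => ‖u k‖) atTop atTop →
      ((κ * ‖h‖ / (α - κ) : ℝ) : EReal) < Filter.limsup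
        (fun k => ((((inner ℂ (N (u k)) (u k) : ℂ).re / ‖u k‖ : ℝ)) : EReal)) atTop)
    (hiii : ∀ u ∈ dom, L u = 0 → ‖u‖ = 1 →
      ((κ * ‖h‖ / (α - κ) + (inner ℂ h u : ℂ).re : ℝ) : EReal) < recessionFunctional N u)
    (z : ℕ → H) (ε : ℕ → ℝ) (hεpos : ∀ k, 0 < ε k) (hε : Tendsto ε atTop (𝓝 0))
    (hzdom : ∀ k, z k ∈ dom)
    (hz : ∀ k, ((1 + ε k : ℝ) : ℂ) • L (z k) + ((ε k * s : ℝ) : ℂ) • z k = h - N (z k))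
    (hform : ∀ k, (inner ℂ (N (z k)) (z k) : ℂ).re ≤
      (inner ℂ h (z k) : ℂ).re + κ * ‖h - N (z k)‖ ^ 2)
    (hzpos : ∀ k, 0 < ‖z k‖)
    (hzinf : Tendsto (fun k => ‖z k‖) atTop atTop) : False := by
  wlog hweak : ∃ v : H, ∀ w : H, Tendsto
      (fun k => (inner ℂ w (((‖z k‖⁻¹ : ℝ) : ℂ) • z k) : ℂ)) atTop (𝓝 (inner ℂ w v))
    generalizing z ε with H
  · obtain ⟨v, φ, hφ, hv⟩ := exists_subseq_weakly_tendsto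
      (fun k => ((‖z k‖⁻¹ : ℝ) : ℂ) • z k) 1 (fun k => by
        rw [norm_smul, Complex.norm_real, norm_inv, norm_norm,
          inv_mul_cancel₀ (hzpos k).ne'])
    exact H (z ∘ φ) (ε ∘ φ) (fun k => hεpos _) (hε.comp hφ.tendsto_atTop) (fun k => hzdom _)
      (fun k => hz _) (fun k => hform _) (fun k => hzpos _) (hzinf.comp hφ.tendsto_atTop) ⟨v, hv⟩
  obtain ⟨v, hv⟩ := hweak
  have hα : 0 < α := hκ.trans_lt hκα
  have hq : 0 < α - κ := sub_pos.2 hκα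
  have hτ : Tendsto (fun k => ‖z k‖⁻¹) atTop (𝓝 0) := hzinf.inv_tendsto_atTop
  have hNlin : ∀ k, ‖N (z k)‖ ≤ ‖z k‖ / α := fun k => by
    have h1 := (Complex.re_le_norm _).trans (norm_inner_le_norm (𝕜 := ℂ) (N (z k)) (z k))
    have h2 := hN (z k)
    rw [le_div_iff₀ hα]
    rcases (norm_nonneg (N (z k))).eq_or_lt with h0 | h0
    · rw [← h0]; simp
    · nlinarith
  have hmain : ∀ k, (α - κ) * (inner ℂ (N (z k)) (z k) : ℂ).re ≤
      α * ((inner ℂ h (z k) : ℂ).re + κ * ‖h‖ ^ 2 + 2 * κ * ‖h‖ * ‖N (z k)‖) := fun k => by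
    have h1 : ‖h - N (z k)‖ ^ 2 ≤ (‖h‖ + ‖N (z k)‖) ^ 2 := by
      gcongr
      exact norm_sub_le _ _
    have h2 := mul_le_mul_of_nonneg_left (hform k) hα.le
    have h3 := mul_le_mul_of_nonneg_left h1 (mul_nonneg hα.le hκ)
    have h4 := mul_le_mul_of_nonneg_left (hN (z k)) hκ
    nlinarith
  have hν2 : Tendsto (fun k => (‖N (z k)‖ * ‖z k‖⁻¹) ^ 2) atTop (𝓝 0) := by
    have hup : Tendsto (fun k => (α - κ)⁻¹ * ((‖h‖ + 2 * κ * ‖h‖ / α) * ‖z k‖⁻¹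
        + κ * ‖h‖ ^ 2 * (‖z k‖⁻¹) ^ 2)) atTop (𝓝 0) := by
      have := ((hτ.const_mul (‖h‖ + 2 * κ * ‖h‖ / α)).add
        ((hτ.pow 2).const_mul (κ * ‖h‖ ^ 2))).const_mul (α - κ)⁻¹
      simpa using this
    refine squeeze_zero (fun k => sq_nonneg _) (fun k => ?_) hup
    have h1 : (α - κ) * ‖N (z k)‖ ^ 2 ≤
        ‖h‖ * ‖z k‖ + κ * ‖h‖ ^ 2 + 2 * κ * ‖h‖ * (‖z k‖ / α) := by
      have h2 := (Complex.re_le_norm _).trans (norm_inner_le_norm (𝕜 := ℂ) h (z k))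
      have h3 := mul_le_mul_of_nonneg_left (hN (z k)) hq.le
      have h4 : 2 * κ * ‖h‖ * ‖N (z k)‖ ≤ 2 * κ * ‖h‖ * (‖z k‖ / α) :=
        mul_le_mul_of_nonneg_left (hNlin k) (by positivity)
      have h5 : α * ((α - κ) * ‖N (z k)‖ ^ 2) ≤
          α * (‖h‖ * ‖z k‖ + κ * ‖h‖ ^ 2 + 2 * κ * ‖h‖ * (‖z k‖ / α)) := by
        have h6 := mul_le_mul_of_nonneg_left (add_le_add h2 h4) hα.le
        have h7 := hmain k
        linarith
      exact le_of_mul_le_mul_left h5 hα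
    rw [inv_mul_eq_div, le_div_iff₀ hq]
    have h8 := mul_le_mul_of_nonneg_right h1 (sq_nonneg ‖z k‖⁻¹)
    have h9 : ‖z k‖ * ‖z k‖⁻¹ = 1 := mul_inv_cancel₀ (hzpos k).ne'
    calc (‖N (z k)‖ * ‖z k‖⁻¹) ^ 2 * (α - κ)
        = (α - κ) * ‖N (z k)‖ ^ 2 * ‖z k‖⁻¹ ^ 2 := by ring
      _ ≤ _ := h8
      _ = (‖h‖ + 2 * κ * ‖h‖ / α) * (‖z k‖ * ‖z k‖⁻¹) * ‖z k‖⁻¹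
          + κ * ‖h‖ ^ 2 * ‖z k‖⁻¹ ^ 2 := by ring
      _ = _ := by rw [h9, mul_one]
  have hν : Tendsto (fun k => ‖N (z k)‖ * ‖z k‖⁻¹) atTop (𝓝 0) := by
    have := hν2.sqrt
    simp only [Real.sqrt_zero] at this
    exact this.congr fun k => Real.sqrt_sq (by positivity)
  have hLv : v ∈ dom ∧ L v = 0 := by
    refine hselfadj v 0 fun u hu => ?_
    have hb : Tendsto (fun k => ‖z k‖⁻¹ * (inner ℂ (L (z k)) u : ℂ)) atTop (𝓝 0) := by
      have hup : Tendsto (fun k => (‖h‖ * ‖z k‖⁻¹ + ‖N (z k)‖ * ‖z k‖⁻¹ + ε k * s) * ‖u‖) atTop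
          (𝓝 0) := by
        simpa using (((hτ.const_mul ‖h‖).add hν).add (hε.mul_const s)).mul_const ‖u‖
      refine squeeze_zero_norm (fun k => ?_) hup
      have h1 : ‖L (z k)‖ ≤ ‖h‖ + ‖N (z k)‖ + ε k * s * ‖z k‖ := by
        have h2 : ((1 + ε k : ℝ) : ℂ) • L (z k) = h - N (z k) - ((ε k * s : ℝ) : ℂ) • z k :=
          eq_sub_of_add_eq (hz k)
        have h3 : ‖((1 + ε k : ℝ) : ℂ) • L (z k)‖ = (1 + ε k) * ‖L (z k)‖ := by
          rw [norm_smul, Complex.norm_real, Real.norm_of_nonneg (by linarith [hεpos k])]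
        have h4 : ‖((ε k * s : ℝ) : ℂ) • z k‖ = ε k * s * ‖z k‖ := by
          rw [norm_smul, Complex.norm_real, Real.norm_of_nonneg (mul_pos (hεpos k) hs).le]
        have h5 := norm_sub_le (h - N (z k)) (((ε k * s : ℝ) : ℂ) • z k)
        rw [← h2, h3, h4] at h5
        nlinarith [norm_sub_le h (N (z k)), mul_nonneg (hεpos k).le (norm_nonneg (L (z k)))]
      rw [norm_mul, Complex.norm_real, norm_inv, norm_norm]
      have h6 : ‖z k‖ * ‖z k‖⁻¹ = 1 := mul_inv_cancel₀ (hzpos k).ne'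
      calc ‖z k‖⁻¹ * ‖(inner ℂ (L (z k)) u : ℂ)‖
          ≤ ‖z k‖⁻¹ * ((‖h‖ + ‖N (z k)‖ + ε k * s * ‖z k‖) * ‖u‖) := by
            gcongr
            exact (norm_inner_le_norm _ _).trans (by gcongr)
        _ = (‖h‖ * ‖z k‖⁻¹ + ‖N (z k)‖ * ‖z k‖⁻¹ + ε k * s * (‖z k‖ * ‖z k‖⁻¹)) * ‖u‖ := by
            ring
        _ = _ := by rw [h6, mul_one]
    have ha := (Complex.continuous_conj.tendsto _).comp (hv (L u))
    rw [inner_conj_symm] at ha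
    rw [inner_zero_left]
    refine tendsto_nhds_unique ha (hb.congr fun k => ?_)
    rw [Function.comp_apply, inner_conj_symm, inner_smul_left, Complex.conj_ofReal,
      hsymm _ (hzdom k) _ hu]
  set f : ℕ → ℝ := fun k => (inner ℂ (N (z k)) (z k) : ℂ).re / ‖z k‖ with hf
  set g : ℕ → ℝ := fun k => α / (α - κ) * ((inner ℂ h (((‖z k‖⁻¹ : ℝ) : ℂ) • z k) : ℂ).re
    + κ * ‖h‖ ^ 2 * ‖z k‖⁻¹ + 2 * κ * ‖h‖ * (‖N (z k)‖ * ‖z k‖⁻¹)) with hg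
  have hfg : ∀ k, f k ≤ g k := fun k => by
    simp only [hf, hg]
    rw [inner_smul_right, Complex.re_ofReal_mul, div_mul_eq_mul_div, le_div_iff₀ hq]
    have h1 := mul_le_mul_of_nonneg_right (hmain k) (inv_nonneg.2 (norm_nonneg (z k)))
    rw [div_eq_mul_inv]
    linarith
  have hglim : Tendsto g atTop (𝓝 (α / (α - κ) * (inner ℂ h v : ℂ).re)) := by
    have h1 := (Complex.continuous_re.tendsto _).comp (hv h)
    have := ((h1.add (hτ.const_mul (κ * ‖h‖ ^ 2))).add
      (hν.const_mul (2 * κ * ‖h‖))).const_mul (α / (α - κ))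
    simp only [mul_zero, add_zero] at this
    exact this
  rcases eq_or_ne v 0 with hv0 | hv0
  · rw [hv0, inner_zero_right, Complex.zero_re, mul_zero] at hglim
    have h1 := hii z hzinf
    have h2 : Filter.limsup (fun k => (f k : EReal)) atTop ≤ ((0 : ℝ) : EReal) := by
      rw [← ((continuous_coe_real_ereal.tendsto 0).comp hglim).limsup_eq]
      exact Filter.limsup_le_limsup (Eventually.of_forall fun k => EReal.coe_le_coe_iff.2 (hfg k))
    have h3 := EReal.coe_lt_coe_iff.1 (h1.trans_le h2)
    have h4 : 0 ≤ κ * ‖h‖ / (α - κ) := by positivity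
    linarith
  · have hvn : 0 < ‖v‖ := norm_pos_iff.2 hv0
    set e : H := ((‖v‖⁻¹ : ℝ) : ℂ) • v with he
    have hen : ‖e‖ = 1 := by
      rw [he, norm_smul, Complex.norm_real, norm_inv, norm_norm, inv_mul_cancel₀ hvn.ne']
    have hedom : e ∈ dom ∧ L e = 0 := by
      refine hselfadj e 0 fun u hu => ?_
      rw [he, inner_smul_left, ← hsymm v hLv.1 u hu, hLv.2, inner_zero_left, mul_zero]
    have h1 := hiii e hedom.1 hedom.2 hen
    have h2 : recessionFunctional N e ≤ Filter.liminf
        (fun k => (((inner ℂ (N (((‖z k‖ * ‖v‖ : ℝ) : ℂ) •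
          (((‖v‖⁻¹ : ℝ) : ℂ) • (((‖z k‖⁻¹ : ℝ) : ℂ) • z k))))
          (((‖v‖⁻¹ : ℝ) : ℂ) • (((‖z k‖⁻¹ : ℝ) : ℂ) • z k)) : ℂ).re : ℝ) : EReal)) atTop := by
      refine sInf_le ⟨fun k => ‖z k‖ * ‖v‖,
        fun k => ((‖v‖⁻¹ : ℝ) : ℂ) • (((‖z k‖⁻¹ : ℝ) : ℂ) • z k),
        fun k => mul_pos (hzpos k) hvn, hzinf.atTop_mul_const hvn, fun w => ?_, rfl⟩
      simp only [he, inner_smul_right _ _ ((‖v‖⁻¹ : ℝ) : ℂ)]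
      exact (hv w).const_mul _
    have h3 : ∀ k, (inner ℂ (N (((‖z k‖ * ‖v‖ : ℝ) : ℂ) •
          (((‖v‖⁻¹ : ℝ) : ℂ) • (((‖z k‖⁻¹ : ℝ) : ℂ) • z k))))
          (((‖v‖⁻¹ : ℝ) : ℂ) • (((‖z k‖⁻¹ : ℝ) : ℂ) • z k)) : ℂ).re = ‖v‖⁻¹ * f k := by
      intro k
      have h4 : ((‖z k‖ * ‖v‖ : ℝ) : ℂ) •
          (((‖v‖⁻¹ : ℝ) : ℂ) • (((‖z k‖⁻¹ : ℝ) : ℂ) • z k)) = z k := by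
        rw [smul_smul, smul_smul, ← Complex.ofReal_mul, ← Complex.ofReal_mul,
          mul_assoc ‖z k‖, mul_inv_cancel₀ hvn.ne', mul_one, mul_inv_cancel₀ (hzpos k).ne',
          Complex.ofReal_one, one_smul]
      rw [h4, inner_smul_right, inner_smul_right, Complex.re_ofReal_mul, Complex.re_ofReal_mul, hf]
      ring
    simp only [h3] at h2
    have h5 : Filter.liminf (fun k => ((‖v‖⁻¹ * f k : ℝ) : EReal)) atTop ≤
        ((‖v‖⁻¹ * (α / (α - κ) * (inner ℂ h v : ℂ).re) : ℝ) : EReal) := by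
      rw [← ((continuous_coe_real_ereal.tendsto _).comp (hglim.const_mul ‖v‖⁻¹)).liminf_eq]
      refine Filter.liminf_le_liminf (Eventually.of_forall fun k => EReal.coe_le_coe_iff.2 ?_)
      exact mul_le_mul_of_nonneg_left (hfg k) (inv_nonneg.2 hvn.le)
    have h6 := EReal.coe_lt_coe_iff.1 ((h1.trans_le h2).trans_le h5)
    have h7 : (inner ℂ h e : ℂ).re = ‖v‖⁻¹ * (inner ℂ h v : ℂ).re := by
      rw [he, inner_smul_right, Complex.re_ofReal_mul]
    have h8 : (inner ℂ h e : ℂ).re ≤ ‖h‖ := by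
      have := (Complex.re_le_norm _).trans (norm_inner_le_norm (𝕜 := ℂ) h e)
      rwa [hen, mul_one] at this
    have h9 : ‖v‖⁻¹ * (α / (α - κ) * (inner ℂ h v : ℂ).re) =
        κ / (α - κ) * (inner ℂ h e : ℂ).re + (inner ℂ h e : ℂ).re := by
      rw [h7]
      field_simp
      ring
    rw [h9, mul_div_right_comm] at h6
    have := mul_le_mul_of_nonneg_left h8 (div_nonneg hκ hq.le)
    linarith

/-- (General spectral-gap setting, main existence theorem.) Assume `N` is
bounded, demicontinuous, `N(0) = 0`, `Re⟪N(u) − N(u'), u − u'⟫ ≥ α‖N(u) − N(u')‖²` with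
`α > γ/δ²`, `limsup Re⟪N(u_k), u_k⟫/‖u_k‖ > γ‖h‖/(δ²α − γ)` whenever `‖u_k‖ → +∞`, and
`J_N(u) > γ‖h‖/(δ²α − γ) + Re⟪h, u⟫` on the unit sphere of `ker L`. Then `Lu + N(u) = h`
has a solution in `dom L`. -/
theorem stmt_16 {H : Type*} [NormedAddCommGroup H] [InnerProductSpace ℂ H] [CompleteSpace H]
    [TopologicalSpace.SeparableSpace H]
    (H₁ dom : Submodule ℂ H) (hcl : IsClosed (H₁ : Set H))
    (hdense : Dense (dom : Set H)) (hH₁dom : H₁ ≤ dom)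
    (P₁ : H → H) (hP₁mem : ∀ u : H, P₁ u ∈ H₁) (hP₁orth : ∀ u : H, u - P₁ u ∈ H₁ᗮ)
    (L : H → H)
    (hlin : ∀ u ∈ dom, ∀ v ∈ dom, ∀ a b : ℂ, L (a • u + b • v) = a • L u + b • L v)
    (hsymm : ∀ u ∈ dom, ∀ v ∈ dom, (inner ℂ (L u) v : ℂ) = inner ℂ u (L v))
    (hselfadj : ∀ v w : H, (∀ u ∈ dom, (inner ℂ v (L u) : ℂ) = inner ℂ w u) → v ∈ dom ∧ L v = w)
    (hinv₁ : ∀ u ∈ H₁, L u ∈ H₁)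
    (hinv₂ : ∀ u ∈ dom, u ∈ H₁ᗮ → L u ∈ H₁ᗮ)
    (γ δ : ℝ) (hδ : 0 < δ) (hγδ : δ ≤ γ)
    (hcoer₁ : ∀ u ∈ H₁,
      -γ * ‖u‖ ^ 2 ≤ (inner ℂ (L u) u : ℂ).re ∧ (inner ℂ (L u) u : ℂ).re ≤ -δ * ‖u‖ ^ 2)
    (hnn₂ : ∀ u ∈ dom, u ∈ H₁ᗮ → 0 ≤ (inner ℂ (L u) u : ℂ).re)
    (h : H) (N : H → H)
    (hNbdd : ∀ s : Set H, Bornology.IsBounded s → Bornology.IsBounded (N '' s))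
    (hNdemi : ∀ (u : ℕ → H) (u₀ : H), Tendsto u atTop (𝓝 u₀) →
      ∀ v : H, Tendsto (fun k => (inner ℂ v (N (u k)) : ℂ)) atTop (𝓝 (inner ℂ v (N u₀))))
    (hN0 : N 0 = 0)
    (α : ℝ) (hα : γ / δ ^ 2 < α)
    (hi : ∀ u u' : H, α * ‖N u - N u'‖ ^ 2 ≤ (inner ℂ (N u - N u') (u - u') : ℂ).re)
    (hii : ∀ u : ℕ → H, Tendsto (fun k => ‖u k‖) atTop atTop →
      ((γ * ‖h‖ / (δ ^ 2 * α - γ) : ℝ) : EReal) < Filter.limsup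
        (fun k => ((((inner ℂ (N (u k)) (u k) : ℂ).re / ‖u k‖ : ℝ)) : EReal)) atTop)
    (hiii : ∀ u ∈ dom, L u = 0 → ‖u‖ = 1 →
      ((γ * ‖h‖ / (δ ^ 2 * α - γ) + (inner ℂ h u : ℂ).re : ℝ) : EReal) <
        recessionFunctional N u) :
    ∃ u ∈ dom, L u + N u = h := by
  have hδ2 : 0 < δ ^ 2 := by positivity
  have hγ : 0 < γ := hδ.trans_le hγδ
  have hκ : 0 < γ / δ ^ 2 := by positivity
  have hαpos : 0 < α := hκ.trans hα
  have hδκ : 1 / δ ≤ γ / δ ^ 2 := by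
    rw [div_le_div_iff₀ hδ hδ2]
    nlinarith
  have hδα : 1 < α * δ := by
    have := hδκ.trans_lt hα
    rwa [div_lt_iff₀ hδ] at this
  set s : ℝ := 1 / (2 * α) with hsdef
  have hs : 0 < s := by positivity
  have hsα : s * α = 1 / 2 := by rw [hsdef]; field_simp
  have hsδ : s + s ≤ δ := by nlinarith
  have hgap := spectral_gap_bounds H₁ dom hH₁dom P₁ hP₁mem hP₁orth L hlin hinv₁ hinv₂ δ
    (fun u hu => (hcoer₁ u hu).2) hnn₂
  have hbelow : ∀ u ∈ dom, s * ‖u‖ ≤ ‖L u + (s : ℂ) • u‖ := fun u hu => by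
    have := (hgap 1 s s one_pos hs.le hs (by linarith) u hu).1
    simpa using this
  choose R hRdom hR using
    exists_add_smul_eq_of_bounded_below dom L hlin hsymm hselfadj s s hs hbelow
  have hsN : ∀ x y : H, ‖((s : ℂ) • x - N x) - ((s : ℂ) • y - N y)‖ ≤ s * ‖x - y‖ := by
    intro x y
    have h1 : ((s : ℂ) • x - N x) - ((s : ℂ) • y - N y) = (s : ℂ) • (x - y) - (N x - N y) := by
      rw [smul_sub]; abel
    have h2 : ‖(s : ℂ) • (x - y) - (N x - N y)‖ ^ 2 = ‖(s : ℂ) • (x - y)‖ ^ 2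
        - 2 * (inner ℂ ((s : ℂ) • (x - y)) (N x - N y) : ℂ).re + ‖N x - N y‖ ^ 2 :=
      norm_sub_sq (𝕜 := ℂ) _ _
    have h3 : (inner ℂ (x - y) (N x - N y) : ℂ).re = (inner ℂ (N x - N y) (x - y) : ℂ).re :=
      inner_re_symm (𝕜 := ℂ) _ _
    rw [inner_smul_left, Complex.conj_ofReal, Complex.re_ofReal_mul, h3, norm_smul,
      Complex.norm_real, Real.norm_of_nonneg hs.le] at h2
    rw [h1]
    refine le_of_sq_le_sq ?_ (by positivity)
    have h4 := mul_le_mul_of_nonneg_left (hi x y) hs.le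
    rw [← mul_assoc, hsα] at h4
    linarith
  set T : H → H := fun x => R (h + ((s : ℂ) • x - N x)) with hTdef
  have hTdom : ∀ x, T x ∈ dom := fun x => hRdom _
  have hTeq : ∀ x, L (T x) + (s : ℂ) • T x = h + ((s : ℂ) • x - N x) := fun x => hR _
  have hT : LipschitzWith 1 T := by
    refine LipschitzWith.of_dist_le_mul fun x y => ?_
    rw [NNReal.coe_one, one_mul, dist_eq_norm, dist_eq_norm]
    have h1 := hbelow _ (dom.sub_mem (hTdom x) (hTdom y))
    have h2 : L (T x - T y) = L (T x) - L (T y) := by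
      have := hlin _ (hTdom x) _ (hTdom y) 1 (-1)
      simpa [sub_eq_add_neg] using this
    have h3 : L (T x - T y) + (s : ℂ) • (T x - T y) =
        ((s : ℂ) • x - N x) - ((s : ℂ) • y - N y) := by
      have h4 : L (T x - T y) + (s : ℂ) • (T x - T y) =
          (L (T x) + (s : ℂ) • T x) - (L (T y) + (s : ℂ) • T y) := by
        rw [h2, smul_sub]; abel
      rw [h4, hTeq, hTeq]; abel
    rw [h3] at h1
    exact le_of_mul_le_mul_left (h1.trans (hsN x y)) hs
  have hconst : γ * ‖h‖ / (δ ^ 2 * α - γ) = γ / δ ^ 2 * ‖h‖ / (α - γ / δ ^ 2) := by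
    have h1 : 0 < α - γ / δ ^ 2 := sub_pos.2 hα
    have h2 : δ ^ 2 * α - γ = δ ^ 2 * (α - γ / δ ^ 2) := by field_simp
    rw [h2]
    field_simp
  rw [hconst] at hii hiii
  have hNsq : ∀ u : H, α * ‖N u‖ ^ 2 ≤ (inner ℂ (N u) u : ℂ).re := fun u => by
    simpa [hN0] using hi u 0
  have hfacts : ∀ ε : ℝ, 0 < ε → ∀ z, T z = ((1 + ε : ℝ) : ℂ) • z → z ∈ dom ∧
      ((1 + ε : ℝ) : ℂ) • L z + ((ε * s : ℝ) : ℂ) • z = h - N z ∧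
      (inner ℂ (N z) z : ℂ).re ≤ (inner ℂ h z : ℂ).re + γ / δ ^ 2 * ‖h - N z‖ ^ 2 := by
    intro ε hε z hz
    have hne : ((1 + ε : ℝ) : ℂ) ≠ 0 := by
      exact_mod_cast (by positivity : (1 + ε : ℝ) ≠ 0)
    have hzd : z ∈ dom := by
      have h1 := hTdom z
      rw [hz] at h1
      exact (dom.smul_mem_iff hne).1 h1
    have heq : ((1 + ε : ℝ) : ℂ) • L z + ((ε * s : ℝ) : ℂ) • z = h - N z := by
      have h1 := hTeq z
      have h2 : L (((1 + ε : ℝ) : ℂ) • z) = ((1 + ε : ℝ) : ℂ) • L z := by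
        simpa using hlin z hzd 0 dom.zero_mem ((1 + ε : ℝ) : ℂ) 0
      rw [hz, h2] at h1
      have h3 : (s : ℂ) • ((1 + ε : ℝ) : ℂ) • z = ((ε * s : ℝ) : ℂ) • z + (s : ℂ) • z := by
        rw [smul_smul, ← add_smul]
        congr 1
        push_cast
        ring
      rw [h3, ← add_assoc] at h1
      have h4 : h + ((s : ℂ) • z - N z) = (h - N z) + (s : ℂ) • z := by abel
      rw [h4] at h1
      exact add_right_cancel h1
    refine ⟨hzd, heq, ?_⟩
    have h1 := (hgap (1 + ε) (ε * s) δ (by linarith) (by positivity) hδ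
      (by nlinarith) z hzd).2
    rw [heq, inner_sub_left, Complex.sub_re] at h1
    have h2 := mul_le_mul_of_nonneg_right hδκ (sq_nonneg ‖h - N z‖)
    linarith
  have hbound : ∃ ε₀ B : ℝ, 0 < ε₀ ∧
      ∀ ε : ℝ, 0 < ε → ε < ε₀ → ∀ z, T z = ((1 + ε : ℝ) : ℂ) • z → ‖z‖ ≤ B := by
    by_contra! hcon
    choose ε hεpos hεlt z hz hzB using fun k : ℕ =>
      hcon (1 / ((k : ℝ) + 1)) k (by positivity)
    refine not_tendsto_norm_atTop_of_regularized dom L hsymm hselfadj h N α (γ / δ ^ 2) s hκ.le hα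
      hs hNsq hii hiii z ε hεpos
      (squeeze_zero (fun k => (hεpos k).le) (fun k => (hεlt k).le)
        tendsto_one_div_add_atTop_nhds_zero_nat)
      (fun k => (hfacts _ (hεpos k) _ (hz k)).1) (fun k => (hfacts _ (hεpos k) _ (hz k)).2.1)
      (fun k => (hfacts _ (hεpos k) _ (hz k)).2.2)
      (fun k => (Nat.cast_nonneg k).trans_lt (hzB k))
      (tendsto_atTop_mono (fun k => (hzB k).le) tendsto_natCast_atTop_atTop)
  obtain ⟨ε₀, B, hε₀, hB⟩ := hbound
  obtain ⟨z, hz⟩ := exists_fixedPoint_of_bounded T hT ε₀ B hε₀ hB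
  have h1 := hTeq z
  have h2 := hTdom z
  rw [hz] at h1 h2
  refine ⟨z, h2, ?_⟩
  have h3 : h + ((s : ℂ) • z - N z) = (h - N z) + (s : ℂ) • z := by abel
  rw [h3] at h1
  rw [add_right_cancel h1]
  abel
end

section
/- Let f : ℝⁿ × ℝ → ℝ be a Carathéodory function with f(x, 0) = 0 for a.e. x, and assume: (i) |f(x,t)| ≤ a(x) + b|t| for a.e. x and all t, where a ∈ L²(ℝⁿ, ℝ) and b > 0; (ii) for a.e. x the function t ↦ f(x,t) is non-decreasing; (iii) there are α, β > 0 such that for a.e. x and every t, β ≤ D̲₂f(x,t) ≤ D̄₂f(x,t) ≤ 1/α. Then the superposition operator N : L²(ℝⁿ, ℝ) → L²(ℝⁿ, ℝ), N(u)(x) = f(x, u(x)), is well-defined, bounded and continuous, and for all u, u' ∈ L²(ℝⁿ, ℝ): ⟨N(u) − N(u'), u − u'⟩ ≥ α‖N(u) − N(u')‖² and ⟨N(u), u⟩ ≥ β‖u‖², where ⟨·,·⟩ and ‖·‖ are the L² inner product and norm. -/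
open Filter Topology MeasureTheory

/-- The upper derivative of `g : ℝ → ℝ` at `t`:
`lim_{δ→0⁺} sup { (g(s) − g(t))/(s − t) : 0 < |s − t| < δ }`, as an extended real number. -/
noncomputable def upperDeriv (g : ℝ → ℝ) (t : ℝ) : EReal :=
  ⨅ δ : {δ : ℝ // 0 < δ}, ⨆ s : {s : ℝ // 0 < |s - t| ∧ |s - t| < δ.1},
    (((g s.1 - g t) / (s.1 - t) : ℝ) : EReal)

/-- The lower derivative of `g : ℝ → ℝ` at `t`:
`lim_{δ→0⁺} inf { (g(s) − g(t))/(s − t) : 0 < |s − t| < δ }`, as an extended real number. -/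
noncomputable def lowerDeriv (g : ℝ → ℝ) (t : ℝ) : EReal :=
  ⨆ δ : {δ : ℝ // 0 < δ}, ⨅ s : {s : ℝ // 0 < |s - t| ∧ |s - t| < δ.1},
    (((g s.1 - g t) / (s.1 - t) : ℝ) : EReal)

theorem eventually_slope_lt_of_upperDeriv_le {g : ℝ → ℝ} {t L r : ℝ}
    (h : upperDeriv g t ≤ (L : EReal)) (hr : L < r) : ∀ᶠ z in 𝓝[>] t, slope g t z < r := by
  have h1 : upperDeriv g t < (r : EReal) := h.trans_lt (by exact_mod_cast hr)
  obtain ⟨δ, hδ⟩ := iInf_lt_iff.1 h1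
  filter_upwards [Ioo_mem_nhdsGT (show t < t + δ.1 by linarith [δ.2])] with z hz
  have hz0 : 0 < z - t := sub_pos.2 hz.1
  have h2 := (le_iSup (fun s : {s : ℝ // 0 < |s - t| ∧ |s - t| < δ.1} =>
    (((g s.1 - g t) / (s.1 - t) : ℝ) : EReal))
    ⟨z, by rw [abs_of_pos hz0]; exact ⟨hz0, by linarith [hz.2]⟩⟩).trans_lt hδ
  rw [slope_def_field]
  exact_mod_cast h2

theorem eventually_lt_slope_of_le_lowerDeriv {g : ℝ → ℝ} {t L r : ℝ}
    (h : (L : EReal) ≤ lowerDeriv g t) (hr : r < L) : ∀ᶠ z in 𝓝[>] t, r < slope g t z := by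
  have h1 : (r : EReal) < lowerDeriv g t := lt_of_lt_of_le (by exact_mod_cast hr) h
  obtain ⟨δ, hδ⟩ := lt_iSup_iff.1 h1
  filter_upwards [Ioo_mem_nhdsGT (show t < t + δ.1 by linarith [δ.2])] with z hz
  have hz0 : 0 < z - t := sub_pos.2 hz.1
  have h2 := hδ.trans_le (iInf_le (fun s : {s : ℝ // 0 < |s - t| ∧ |s - t| < δ.1} =>
    (((g s.1 - g t) / (s.1 - t) : ℝ) : EReal))
    ⟨z, by rw [abs_of_pos hz0]; exact ⟨hz0, by linarith [hz.2]⟩⟩)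
  rw [slope_def_field]
  exact_mod_cast h2

theorem sub_le_mul_of_frequently_slope_lt {g : ℝ → ℝ} (hg : Continuous g) {L : ℝ}
    (h : ∀ t r, L < r → ∃ᶠ z in 𝓝[>] t, slope g t z < r) {s t : ℝ} (hst : s ≤ t) :
    g t - g s ≤ L * (t - s) := by
  have hB : ∀ x, HasDerivAt (fun y => g s + L * (y - s)) L x := fun x => by
    simpa using (((hasDerivAt_id x).sub_const s).const_mul L).const_add (g s)
  have := image_le_of_liminf_slope_right_le_deriv_boundary (a := s) (b := t) (B' := fun _ => L)
    hg.continuousOn (B := fun y => g s + L * (y - s)) (by simp) (by fun_prop)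
    (fun x _ => (hB x).hasDerivWithinAt) (fun x _ r hr => h x r hr) (Set.right_mem_Icc.2 hst)
  linarith

theorem sub_le_mul_of_upperDeriv_le {g : ℝ → ℝ} (hg : Continuous g) {L : ℝ}
    (h : ∀ t, upperDeriv g t ≤ (L : EReal)) {s t : ℝ} (hst : s ≤ t) :
    g t - g s ≤ L * (t - s) :=
  sub_le_mul_of_frequently_slope_lt hg
    (fun t _ hr => (eventually_slope_lt_of_upperDeriv_le (h t) hr).frequently) hst

theorem mul_le_sub_of_le_lowerDeriv {g : ℝ → ℝ} (hg : Continuous g) {L : ℝ}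
    (h : ∀ t, (L : EReal) ≤ lowerDeriv g t) {s t : ℝ} (hst : s ≤ t) :
    L * (t - s) ≤ g t - g s := by
  have := sub_le_mul_of_frequently_slope_lt (g := fun x => -g x) (L := -L) hg.neg (fun t r hr => by
    refine Eventually.frequently ?_
    filter_upwards [eventually_lt_slope_of_le_lowerDeriv (h t) (neg_lt.1 hr)] with z hz
    rw [slope_def_field] at hz ⊢
    rw [show (-g z - -g t) / (z - t) = -((g z - g t) / (z - t)) by ring]
    linarith) hst
  linarith

theorem mul_abs_sub_le_of_upperDeriv_le {g : ℝ → ℝ} (hg : Continuous g) (hm : Monotone g)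
    {L : ℝ} (h : ∀ t, upperDeriv g t ≤ (L : EReal)) (s t : ℝ) :
    |g s - g t| ≤ L * |s - t| := by
  wlog hst : t ≤ s generalizing s t
  · rw [abs_sub_comm, abs_sub_comm s]
    exact this t s (le_of_not_ge hst)
  rw [abs_of_nonneg (sub_nonneg.2 (hm hst)), abs_of_nonneg (sub_nonneg.2 hst)]
  exact sub_le_mul_of_upperDeriv_le hg h hst

theorem mul_sq_sub_le_of_upperDeriv_le {g : ℝ → ℝ} (hg : Continuous g) (hm : Monotone g)
    {α : ℝ} (hα : 0 < α) (h : ∀ t, upperDeriv g t ≤ ((1 / α : ℝ) : EReal)) (s t : ℝ) :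
    α * (g s - g t) ^ 2 ≤ (g s - g t) * (s - t) := by
  wlog hst : t ≤ s generalizing s t
  · linarith [this t s (le_of_not_ge hst)]
  have h1 := sub_le_mul_of_upperDeriv_le hg h hst
  have h2 : α * (g s - g t) ≤ s - t := by
    rwa [one_div_mul_eq_div, le_div_iff₀' hα] at h1
  have h3 := mul_le_mul_of_nonneg_left h2 (sub_nonneg.2 (hm hst))
  linarith

theorem mul_sq_sub_le_of_le_lowerDeriv {g : ℝ → ℝ} (hg : Continuous g)
    {β : ℝ} (h : ∀ t, (β : EReal) ≤ lowerDeriv g t) (s t : ℝ) :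
    β * (s - t) ^ 2 ≤ (g s - g t) * (s - t) := by
  wlog hst : t ≤ s generalizing s t
  · linarith [this t s (le_of_not_ge hst)]
  have h1 := mul_le_mul_of_nonneg_right (mul_le_sub_of_le_lowerDeriv hg h hst) (sub_nonneg.2 hst)
  linarith

/-- Superposition of a Carathéodory function with an a.e.-measurable function is
a.e.-strongly measurable. -/
theorem aestronglyMeasurable_superposition {X : Type*} [MeasurableSpace X] {μ : Measure X}
    {f : X → ℝ → ℝ} (hmeas : ∀ t, Measurable fun x => f x t)
    (hcont : ∀ᵐ x ∂μ, Continuous (f x)) {u : X → ℝ} (hu : AEStronglyMeasurable u μ) :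
    AEStronglyMeasurable (fun x => f x (u x)) μ := by
  classical
  obtain ⟨S, hSμ, hS, hSc⟩ := hcont.exists_measurable_mem
  let F : X → ℝ → ℝ := fun x t => if x ∈ S then f x t else 0
  have hF : StronglyMeasurable (Function.uncurry fun t x => F x t) := by
    refine stronglyMeasurable_uncurry_of_continuous_of_stronglyMeasurable (fun x => ?_)
      (fun t => (Measurable.ite hS (hmeas t) measurable_const).stronglyMeasurable)
    by_cases hx : x ∈ S
    · simpa [F, hx] using hSc x hx
    · simpa [F, hx] using continuous_const
  refine ⟨fun x => F x (hu.mk u x), hF.comp_measurable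
    (hu.stronglyMeasurable_mk.measurable.prodMk measurable_id), ?_⟩
  filter_upwards [hu.ae_eq_mk, hSμ] with x hx hxS
  simp [F, hxS, hx]

/-- Under growth, monotonicity and derivative bounds on a Carathéodory
function `f`, the superposition operator `N(u)(x) = f(x, u(x))` is a well-defined, bounded and
continuous operator on `L²(ℝⁿ, ℝ)` satisfying
`⟪N(u) − N(u'), u − u'⟫ ≥ α‖N(u) − N(u')‖²` and `⟪N(u), u⟫ ≥ β‖u‖²`. -/
theorem stmt_17 {n : ℕ} (f : EuclideanSpace ℝ (Fin n) → ℝ → ℝ)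
    (hmeas : ∀ t : ℝ, Measurable fun x => f x t)
    (hcont : ∀ᵐ x : EuclideanSpace ℝ (Fin n), Continuous (f x))
    (hzero : ∀ᵐ x : EuclideanSpace ℝ (Fin n), f x 0 = 0)
    (a : EuclideanSpace ℝ (Fin n) → ℝ) (ha : MemLp a 2 (volume : Measure (EuclideanSpace ℝ (Fin n))))
    (b : ℝ) (hb : 0 < b)
    (hgrowth : ∀ᵐ x : EuclideanSpace ℝ (Fin n), ∀ t : ℝ, |f x t| ≤ a x + b * |t|)
    (hmono : ∀ᵐ x : EuclideanSpace ℝ (Fin n), Monotone (f x))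
    (α β : ℝ) (hα : 0 < α) (hβ : 0 < β)
    (hderiv : ∀ᵐ x : EuclideanSpace ℝ (Fin n), ∀ t : ℝ,
      ((β : ℝ) : EReal) ≤ lowerDeriv (f x) t ∧ upperDeriv (f x) t ≤ ((1 / α : ℝ) : EReal)) :
    ∃ N : Lp ℝ 2 (volume : Measure (EuclideanSpace ℝ (Fin n))) →
        Lp ℝ 2 (volume : Measure (EuclideanSpace ℝ (Fin n))),
      (∀ u, (N u : EuclideanSpace ℝ (Fin n) → ℝ) =ᵐ[volume] fun x => f x (u x)) ∧
      (∀ s, Bornology.IsBounded s → Bornology.IsBounded (N '' s)) ∧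
      Continuous N ∧
      (∀ u u', α * ‖N u - N u'‖ ^ 2 ≤ (inner ℝ (N u - N u') (u - u') : ℝ)) ∧
      (∀ u, β * ‖u‖ ^ 2 ≤ (inner ℝ (N u) u : ℝ)) := by
  have hα' : 0 ≤ 1 / α := by positivity
  have hlip : ∀ᵐ x : EuclideanSpace ℝ (Fin n), ∀ s t : ℝ,
      |f x s - f x t| ≤ 1 / α * |s - t| := by
    filter_upwards [hcont, hmono, hderiv] with x hc hm hd
    exact mul_abs_sub_le_of_upperDeriv_le hc hm fun t => (hd t).2
  have hmem : ∀ u : Lp ℝ 2 (volume : Measure (EuclideanSpace ℝ (Fin n))),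
      MemLp (fun x => f x (u x)) 2 (volume : Measure (EuclideanSpace ℝ (Fin n))) := by
    intro u
    refine (Lp.memLp u).of_le_mul (c := 1 / α)
      (aestronglyMeasurable_superposition hmeas hcont (Lp.aestronglyMeasurable u)) ?_
    filter_upwards [hlip, hzero] with x hx h0
    simpa [h0] using hx (u x) 0
  let N : Lp ℝ 2 (volume : Measure (EuclideanSpace ℝ (Fin n))) →
      Lp ℝ 2 (volume : Measure (EuclideanSpace ℝ (Fin n))) := fun u => (hmem u).toLp _
  have hN : ∀ u, (N u : EuclideanSpace ℝ (Fin n) → ℝ) =ᵐ[volume] fun x => f x (u x) :=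
    fun u => (hmem u).coeFn_toLp
  have hNlip : LipschitzWith (Real.toNNReal (1 / α)) N := by
    refine LipschitzWith.of_dist_le_mul fun u v => ?_
    rw [dist_eq_norm, dist_eq_norm, Real.coe_toNNReal _ hα']
    refine Lp.norm_le_mul_norm_of_ae_le_mul ?_
    filter_upwards [hlip, hN u, hN v, Lp.coeFn_sub (N u) (N v), Lp.coeFn_sub u v]
      with x hx hu hv h1 h2
    rw [h1, h2, Pi.sub_apply, Pi.sub_apply, hu, hv]
    exact hx _ _
  refine ⟨N, hN, fun s hs => hNlip.isBounded_image hs, hNlip.continuous, fun u v => ?_,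
    fun u => ?_⟩
  · rw [← real_inner_self_eq_norm_sq, L2.inner_def, L2.inner_def, ← integral_const_mul]
    refine integral_mono_ae ((L2.integrable_inner _ _).const_mul _) (L2.integrable_inner _ _) ?_
    filter_upwards [hcont, hmono, hderiv, hN u, hN v, Lp.coeFn_sub (N u) (N v), Lp.coeFn_sub u v]
      with x hc hm hd hu hv h1 h2
    have := mul_sq_sub_le_of_upperDeriv_le hc hm hα (fun t => (hd t).2) (u x) (v x)
    simp only [h1, h2, Pi.sub_apply, hu, hv, real_inner_self_eq_norm_sq, Real.norm_eq_abs, sq_abs]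
    simpa [mul_comm] using this
  · rw [← real_inner_self_eq_norm_sq, L2.inner_def, L2.inner_def, ← integral_const_mul]
    refine integral_mono_ae ((L2.integrable_inner _ _).const_mul _) (L2.integrable_inner _ _) ?_
    filter_upwards [hcont, hzero, hderiv, hN u] with x hc h0 hd hu
    have := mul_sq_sub_le_of_le_lowerDeriv hc (fun t => (hd t).1) (u x) 0
    simp only [hu, real_inner_self_eq_norm_sq, Real.norm_eq_abs, sq_abs]
    simpa [h0, mul_comm] using this
end
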